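/- arXiv:1802.01932 — 3 statements merged into one kernel-verified Lean document; each statement's English description precedes it below -/
import Mathlib

section
/- Vanishing moment of the second-order bubble correction: ∫_{ℝ²} S₀(|y|) / (1 + |y|²)² dy = 0. -/
open MeasureTheory

/-- `T₀(r) = log(1 + r²)`. -/
noncomputable def T0 (r : ℝ) : ℝ := Real.log (1 + r ^ 2)

/-- The explicit second-order bubble correction `S₀`. -/
noncomputable def S0 (r : ℝ) : ℝ :=
  -T0 r + 2 * r ^ 2 / (1 + r ^ 2) - T0 r ^ 2 / 2 +
    ((1 - r ^ 2) / (1 + r ^ 2)) * ∫ t in (1 : ℝ)..(1 + r ^ 2), Real.log t / (1 - t)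

open Set Filter Topology

/-- The integral defining `S0` has a continuous integrand once it is extended by its limit. -/
lemma integral_log_div_one_sub_eq_neg_integral_dslope (s : ℝ) :
    ∫ t in (1 : ℝ)..s, Real.log t / (1 - t) = -∫ t in (1 : ℝ)..s, dslope Real.log 1 t := by
  rw [← intervalIntegral.integral_neg]
  refine intervalIntegral.integral_congr_ae ?_
  filter_upwards [compl_mem_ae_iff.mpr (measure_singleton (1 : ℝ))] with t ht _
  have ht : t ≠ 1 := ht
  have h1 : t - 1 ≠ 0 := sub_ne_zero.mpr ht
  have h2 : 1 - t ≠ 0 := sub_ne_zero.mpr ht.symm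
  rw [dslope_of_ne _ ht, slope_def_field, Real.log_one]
  field_simp
  ring

lemma hasDerivAt_integral_log_div_one_sub {s : ℝ} (hs : 0 < s) :
    HasDerivAt (fun u ↦ ∫ t in (1 : ℝ)..u, Real.log t / (1 - t)) (-dslope Real.log 1 s) s := by
  have hcont : ContinuousOn (dslope Real.log 1) (Ioi 0) := by
    rw [continuousOn_dslope (Ioi_mem_nhds one_pos)]
    exact ⟨Real.continuousOn_log.mono fun x hx ↦ ne_of_gt hx, Real.differentiableAt_log one_ne_zero⟩
  simp_rw [integral_log_div_one_sub_eq_neg_integral_dslope]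
  refine (intervalIntegral.integral_hasDerivAt_right ?_ ?_
    (hcont.continuousAt (Ioi_mem_nhds hs))).fun_neg
  · refine (hcont.mono fun t ht ↦ ?_).intervalIntegrable
    exact (lt_min one_pos hs).trans_le ht.1
  · exact hcont.stronglyMeasurableAtFilter isOpen_Ioi s hs

lemma abs_integral_log_div_one_sub_le {s : ℝ} (hs : 1 ≤ s) :
    |∫ t in (1 : ℝ)..s, Real.log t / (1 - t)| ≤ 4 * s ^ (1 / 2 : ℝ) := by
  have hbound : ∀ t ∈ Ioc 1 s, ‖Real.log t / (1 - t)‖ ≤ 2 * t ^ (-(1 / 2) : ℝ) := by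
    intro t ht
    have ht1 : 1 < t := ht.1
    have ht0 : 0 < t := by linarith
    have hu : 1 < √t := by rwa [Real.lt_sqrt zero_le_one, one_pow]
    have hsq : √t * √t = t := Real.mul_self_sqrt ht0.le
    have hlog : Real.log t ≤ 2 * (√t - 1) := by
      have := Real.log_le_sub_one_of_pos (show 0 < √t by linarith)
      rw [Real.log_sqrt ht0.le] at this
      linarith
    rw [Real.rpow_neg ht0.le, ← Real.sqrt_eq_rpow, Real.norm_eq_abs, abs_div,
      abs_of_nonneg (Real.log_nonneg ht1.le), abs_sub_comm, abs_of_pos (by linarith),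
      ← div_eq_mul_inv, div_le_div_iff₀ (by linarith) (by linarith)]
    nlinarith
  have hint : IntervalIntegrable (fun t : ℝ ↦ 2 * t ^ (-(1 / 2) : ℝ)) volume 1 s :=
    (intervalIntegral.intervalIntegrable_rpow' (by norm_num)).const_mul 2
  have h := intervalIntegral.norm_integral_le_of_norm_le hs (ae_of_all _ hbound) hint
  rw [intervalIntegral.integral_const_mul, integral_rpow (Or.inl (by norm_num))] at h
  rw [Real.norm_eq_abs] at h
  norm_num at h ⊢
  linarith

lemma log_le_two_mul_rpow_half {s : ℝ} (hs : 0 ≤ s) : Real.log s ≤ 2 * s ^ (1 / 2 : ℝ) := by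
  have := Real.log_le_rpow_div hs (show (0 : ℝ) < 1 / 2 by norm_num)
  linarith

lemma log_sq_le_rpow_half {s : ℝ} (hs : 1 ≤ s) : Real.log s ^ 2 ≤ 16 * s ^ (1 / 2 : ℝ) := by
  have h := Real.log_le_rpow_div (zero_le_one.trans hs) (show (0 : ℝ) < 1 / 4 by norm_num)
  have hpow : s ^ (1 / 2 : ℝ) = (s ^ (1 / 4 : ℝ)) ^ 2 := by
    rw [← Real.rpow_mul_natCast (by linarith)]
    norm_num
  rw [hpow, show 16 * (s ^ (1 / 4 : ℝ)) ^ 2 = (s ^ (1 / 4 : ℝ) / (1 / 4)) ^ 2 by ring]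
  exact pow_le_pow_left₀ (Real.log_nonneg hs) h 2

lemma continuous_S0 : Continuous S0 := by
  have hT : Continuous T0 := by
    unfold T0
    exact Continuous.log (by fun_prop) fun r ↦ by positivity
  have hD : Continuous fun r : ℝ ↦ ∫ t in (1 : ℝ)..(1 + r ^ 2), Real.log t / (1 - t) := by
    refine continuous_iff_continuousAt.mpr fun r ↦ ?_
    exact (hasDerivAt_integral_log_div_one_sub (by positivity)).continuousAt.comp
      (f := fun r : ℝ ↦ 1 + r ^ 2) (by fun_prop)
  have hne : ∀ r : ℝ, 1 + r ^ 2 ≠ 0 := fun r ↦ by positivity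
  unfold S0
  fun_prop (disch := assumption)

lemma abs_S0_le (r : ℝ) : |S0 r| ≤ 16 * (1 + r ^ 2) ^ (1 / 2 : ℝ) := by
  have hs : 1 ≤ 1 + r ^ 2 := by nlinarith [sq_nonneg r]
  have hD := abs_integral_log_div_one_sub_le hs
  have hL := log_le_two_mul_rpow_half (zero_le_one.trans hs)
  have hL0 := Real.log_nonneg hs
  have hL2 := log_sq_le_rpow_half hs
  have hs2 : 1 ≤ (1 + r ^ 2) ^ (1 / 2 : ℝ) := Real.one_le_rpow hs (by norm_num)
  have hfrac : |(1 - r ^ 2) / (1 + r ^ 2)| ≤ 1 := by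
    rw [abs_div, abs_of_pos (by linarith : 0 < 1 + r ^ 2), div_le_one (by linarith), abs_le]
    constructor <;> nlinarith [sq_nonneg r]
  have hfrac' : 2 * r ^ 2 / (1 + r ^ 2) ≤ 2 := by
    rw [div_le_iff₀ (by linarith)]
    linarith
  have hfrac0 : 0 ≤ 2 * r ^ 2 / (1 + r ^ 2) := by positivity
  have hprod := (abs_mul ((1 - r ^ 2) / (1 + r ^ 2)) _).trans_le
    (mul_le_mul hfrac hD (abs_nonneg _) zero_le_one)
  rw [abs_le] at hprod ⊢
  unfold S0 T0
  constructor <;> nlinarith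

lemma integrable_S0_div_one_add_normSq_sq :
    Integrable fun y : EuclideanSpace ℝ (Fin 2) ↦ S0 ‖y‖ / (1 + ‖y‖ ^ 2) ^ 2 := by
  have h3 : (Module.finrank ℝ (EuclideanSpace ℝ (Fin 2)) : ℝ) < 3 := by
    rw [finrank_euclideanSpace_fin]
    norm_num
  refine ((integrable_rpow_neg_one_add_norm_sq h3).const_mul 16).mono' ?_ (ae_of_all _ fun y ↦ ?_)
  · refine Continuous.aestronglyMeasurable ?_
    exact (continuous_S0.comp continuous_norm).div (by fun_prop) fun y ↦ by positivity
  · have hs : 0 < 1 + ‖y‖ ^ 2 := by positivity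
    rw [Real.norm_eq_abs, abs_div, abs_of_pos (by positivity : 0 < (1 + ‖y‖ ^ 2) ^ 2),
      div_le_iff₀ (by positivity), mul_assoc, ← Real.rpow_add_natCast hs.ne',
      show (-3 / 2 : ℝ) + (2 : ℕ) = 1 / 2 by norm_num]
    exact abs_S0_le ‖y‖

/-- A primitive of `r * S0 r / (1 + r²)²`, written in terms of `s = 1 + r²`. -/
noncomputable def S0RadialPrimitive (s : ℝ) : ℝ :=
  ((s - 1) / s ^ 2 * (∫ t in (1 : ℝ)..s, Real.log t / (1 - t)) + 1 / s ^ 2 +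
    (Real.log s ^ 2 / 2 + Real.log s - 1) / s) / 2

lemma hasDerivAt_S0RadialPrimitive (r : ℝ) :
    HasDerivAt (fun r ↦ S0RadialPrimitive (1 + r ^ 2)) (r * (S0 r / (1 + r ^ 2) ^ 2)) r := by
  have hs : 0 < 1 + r ^ 2 := by positivity
  have hD := hasDerivAt_integral_log_div_one_sub hs
  have hL := Real.hasDerivAt_log hs.ne'
  have hid := hasDerivAt_id' (1 + r ^ 2)
  have hsq := hid.fun_pow 2
  have hne : (1 + r ^ 2) ^ 2 ≠ 0 := by positivity
  have hF := (((((hid.sub_const 1).fun_div hsq hne).fun_mul hD).fun_add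
    ((hasDerivAt_const _ (1 : ℝ)).fun_div hsq hne)).fun_add
    (((((hL.fun_pow 2).div_const 2).fun_add hL).sub_const 1).fun_div hid hs.ne')).div_const 2
  have hinner : HasDerivAt (fun r : ℝ ↦ 1 + r ^ 2) (2 * r) r := by
    simpa using (hasDerivAt_pow 2 r).const_add 1
  have hlog : r ^ 2 * dslope Real.log 1 (1 + r ^ 2) = Real.log (1 + r ^ 2) := by
    have := sub_smul_dslope Real.log 1 (1 + r ^ 2)
    simpa using this
  convert! hF.comp r hinner using 1
  unfold S0 T0
  generalize (∫ t in (1 : ℝ)..(1 + r ^ 2), Real.log t / (1 - t)) = D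
  rw [← hlog]
  field_simp
  ring

lemma tendsto_S0RadialPrimitive_atTop : Tendsto S0RadialPrimitive atTop (𝓝 0) := by
  refine squeeze_zero_norm' (a := fun s ↦ 8 * s ^ (-(1 / 2) : ℝ)) ?_ ?_
  · filter_upwards [eventually_ge_atTop 1] with s hs
    have hs0 : 0 < s := by linarith
    have hD := abs_integral_log_div_one_sub_le hs
    have hL := log_le_two_mul_rpow_half hs0.le
    have hL0 := Real.log_nonneg hs
    have hL2 := log_sq_le_rpow_half hs
    have hs2 : 1 ≤ s ^ (1 / 2 : ℝ) := Real.one_le_rpow hs (by norm_num)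
    have hpow : s ^ (-(1 / 2) : ℝ) = s ^ (1 / 2 : ℝ) / s := by
      rw [← Real.rpow_sub_one hs0.ne']
      norm_num
    have hfrac : |(s - 1) / s| ≤ 1 := by
      rw [abs_of_nonneg (div_nonneg (by linarith) hs0.le), div_le_one hs0]
      linarith
    have hinv : 1 / s ≤ 1 := by rwa [div_le_one hs0]
    have hinv0 : 0 < 1 / s := by positivity
    have hprod := (abs_mul ((s - 1) / s) _).trans_le
      (mul_le_mul hfrac hD (abs_nonneg _) zero_le_one)
    have hfactor : S0RadialPrimitive s =
        ((s - 1) / s * (∫ t in (1 : ℝ)..s, Real.log t / (1 - t)) + 1 / s +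
          (Real.log s ^ 2 / 2 + Real.log s - 1)) / 2 / s := by
      unfold S0RadialPrimitive
      field_simp
    rw [hfactor, hpow, Real.norm_eq_abs, abs_div, abs_of_pos hs0, ← mul_div_assoc]
    gcongr
    rw [abs_le] at hprod ⊢
    constructor <;> nlinarith
  · simpa using (tendsto_rpow_neg_atTop (show (0 : ℝ) < 1 / 2 by norm_num)).const_mul 8

/-- Vanishing moment of the second-order bubble correction:
`∫_{ℝ²} S₀(|y|) / (1 + |y|²)² dy = 0`. -/
theorem integral_S0_div_one_add_normSq_sq_eq_zero :
    ∫ y : EuclideanSpace ℝ (Fin 2), S0 ‖y‖ / (1 + ‖y‖ ^ 2) ^ 2 = 0 := by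
  have hint := (integrable_fun_norm_addHaar (volume : Measure (EuclideanSpace ℝ (Fin 2)))
    (f := fun r ↦ S0 r / (1 + r ^ 2) ^ 2)).mp integrable_S0_div_one_add_normSq_sq
  rw [integral_fun_norm_addHaar volume fun r ↦ S0 r / (1 + r ^ 2) ^ 2]
  simp only [finrank_euclideanSpace_fin, Nat.add_one_sub_one, pow_one, smul_eq_mul] at hint ⊢
  have htend : Tendsto (fun r : ℝ ↦ S0RadialPrimitive (1 + r ^ 2)) atTop (𝓝 0) :=
    tendsto_S0RadialPrimitive_atTop.comp
      (tendsto_atTop_add_const_left _ _ (tendsto_pow_atTop two_ne_zero))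
  rw [integral_Ioi_of_hasDerivAt_of_tendsto' (fun r _ ↦ hasDerivAt_S0RadialPrimitive r) hint htend]
  simp [S0RadialPrimitive]
end

section
/- Asymptotic expansion of S₀ at infinity: there exist constants C > 0 and r₀ > 1 such that for all r ≥ r₀, |S₀(r) + 2·log r − (π²/6 + 2)| ≤ C·(log r)²/r²; in particular S₀(r) = −2 log r + π²/6 + 2 + O((log r)²/r²) as r → ∞. -/
open MeasureTheory

lemma dslope_log_one_of_ne {t : ℝ} (ht : t ≠ 1) : dslope Real.log 1 t = Real.log t / (t - 1) := by
  simp [dslope_of_ne _ ht, slope_def_field]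

lemma continuousOn_dslope_log_one : ContinuousOn (dslope Real.log 1) (Set.Ioi 0) := by
  refine (continuousOn_dslope (Ioi_mem_nhds one_pos)).2
    ⟨Real.continuousOn_log.mono fun x hx => ne_of_gt hx, Real.differentiableAt_log one_ne_zero⟩

lemma intervalIntegrable_dslope_log_one {a b : ℝ} (ha : 0 < a) (hb : 0 < b) :
    IntervalIntegrable (dslope Real.log 1) volume a b :=
  ContinuousOn.intervalIntegrable <| continuousOn_dslope_log_one.mono fun _ hx =>
    lt_of_lt_of_le (lt_min ha hb) hx.1

lemma hasDerivAt_integral_dslope_log_one {x : ℝ} (hx : 0 < x) :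
    HasDerivAt (fun y => ∫ t in (1 : ℝ)..y, dslope Real.log 1 t) (dslope Real.log 1 x) x :=
  intervalIntegral.integral_hasDerivAt_right (intervalIntegrable_dslope_log_one one_pos hx)
    (continuousOn_dslope_log_one.stronglyMeasurableAtFilter isOpen_Ioi x hx)
    (continuousOn_dslope_log_one.continuousAt (Ioi_mem_nhds hx))

/-- The functional equation relating the slope integral at `x` and at `x⁻¹`. -/
lemma integral_dslope_log_one_add_inv {x : ℝ} (hx : 0 < x) :
    (∫ t in (1 : ℝ)..x, dslope Real.log 1 t) + ∫ t in (1 : ℝ)..x⁻¹, dslope Real.log 1 t =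
      Real.log x ^ 2 / 2 := by
  set H : ℝ → ℝ := fun y => ∫ t in (1 : ℝ)..y, dslope Real.log 1 t with hH
  have hd : ∀ y ∈ Set.Ioi (0 : ℝ),
      HasDerivAt (fun y => H y + H y⁻¹ - Real.log y ^ 2 / 2) 0 y := by
    intro y hy
    have hy0 : (0 : ℝ) < y := hy
    have h := ((hasDerivAt_integral_dslope_log_one hy0).add
      ((hasDerivAt_integral_dslope_log_one (inv_pos.2 hy0)).comp y
        (hasDerivAt_inv hy0.ne'))).sub (((Real.hasDerivAt_log hy0.ne').pow 2).div_const 2)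
    refine h.congr_deriv ?_
    rcases eq_or_ne y 1 with rfl | hy1
    · simp
    · have h1 : y - 1 ≠ 0 := sub_ne_zero.2 hy1
      have h2 : 1 - y ≠ 0 := sub_ne_zero.2 hy1.symm
      have h3 : y⁻¹ - 1 = (1 - y) / y := by field_simp
      rw [dslope_log_one_of_ne hy1, dslope_log_one_of_ne (by simpa using hy1), h3, Real.log_inv]
      field_simp
      ring
  have hc := (convex_Ioi (0 : ℝ)).is_const_of_fderivWithin_eq_zero (𝕜 := ℝ)
    (fun y hy => (hd y hy).differentiableAt.differentiableWithinAt)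
    (fun y hy => by
      rw [fderivWithin_of_isOpen isOpen_Ioi hy]
      ext
      simpa using (hd y hy).deriv)
    (Set.mem_Ioi.2 hx) (Set.mem_Ioi.2 one_pos)
  have h1 : H 1 = 0 := by simp [hH]
  simp only [inv_one, h1, Real.log_one] at hc
  linarith

lemma dslope_log_one_nonneg {u : ℝ} (hu : 0 < u) (hu1 : u ≤ 1) : 0 ≤ dslope Real.log 1 u := by
  rcases eq_or_lt_of_le hu1 with rfl | h
  · simp
  · rw [dslope_log_one_of_ne h.ne]
    exact div_nonneg_of_nonpos (Real.log_nonpos hu.le hu1) (by linarith)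

lemma dslope_log_one_le {u : ℝ} (hu : 0 < u) (hu1 : u ≤ 1) :
    dslope Real.log 1 u ≤ 1 - Real.log u := by
  rcases eq_or_lt_of_le hu1 with rfl | h
  · simp
  · rw [dslope_log_one_of_ne h.ne, div_le_iff_of_neg (by linarith)]
    have h2 := mul_le_mul_of_nonneg_left (Real.one_sub_inv_le_log_of_pos hu) hu.le
    rw [mul_sub, mul_inv_cancel₀ hu.ne'] at h2
    nlinarith

lemma intervalIntegrable_dslope_log_one_zero {y : ℝ} (hy : 0 ≤ y) (hy1 : y ≤ 1) :
    IntervalIntegrable (dslope Real.log 1) volume 0 y := by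
  have hg : IntervalIntegrable (fun u => 1 - Real.log u) volume 0 y :=
    intervalIntegrable_const.sub intervalIntegral.intervalIntegrable_log'
  refine hg.mono_fun ?_ ?_
  · rw [Set.uIoc_of_le hy]
    exact (continuousOn_dslope_log_one.mono fun _ h => h.1).aestronglyMeasurable measurableSet_Ioc
  · rw [Set.uIoc_of_le hy]
    refine (ae_restrict_iff' measurableSet_Ioc).2 (Filter.Eventually.of_forall fun u hu => ?_)
    have h0 := dslope_log_one_nonneg hu.1 (hu.2.trans hy1)
    have h1 := dslope_log_one_le hu.1 (hu.2.trans hy1)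
    beta_reduce
    rwa [Real.norm_of_nonneg h0, Real.norm_of_nonneg (h0.trans h1)]

lemma integral_dslope_log_one_zero_nonneg {y : ℝ} (hy : 0 ≤ y) (hy1 : y ≤ 1) :
    0 ≤ ∫ u in (0 : ℝ)..y, dslope Real.log 1 u := by
  rw [intervalIntegral.integral_of_le hy]
  exact setIntegral_nonneg measurableSet_Ioc fun u hu =>
    dslope_log_one_nonneg hu.1 (hu.2.trans hy1)

lemma integral_dslope_log_one_zero_le {y : ℝ} (hy : 0 ≤ y) (hy1 : y ≤ 1) :
    ∫ u in (0 : ℝ)..y, dslope Real.log 1 u ≤ y * (2 - Real.log y) := by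
  have h := intervalIntegral.integral_mono_on_of_le_Ioo hy
    (intervalIntegrable_dslope_log_one_zero hy hy1)
    (intervalIntegrable_const.sub intervalIntegral.intervalIntegrable_log')
    (fun u hu => dslope_log_one_le hu.1 (hu.2.le.trans hy1))
  refine h.trans_eq ?_
  rw [intervalIntegral.integral_sub intervalIntegrable_const
    intervalIntegral.intervalIntegrable_log', integral_log]
  simp
  ring

lemma intervalIntegrable_neg_pow_mul_log (n : ℕ) (a b : ℝ) :
    IntervalIntegrable (fun u : ℝ => -(u ^ n * Real.log u)) volume a b :=
  (intervalIntegral.intervalIntegrable_log'.continuousOn_mul (continuous_pow n).continuousOn).neg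

lemma integral_neg_pow_mul_log (n : ℕ) :
    ∫ u in (0 : ℝ)..1, -(u ^ n * Real.log u) = 1 / ((n : ℝ) + 1) ^ 2 := by
  have hn : (n : ℝ) + 1 ≠ 0 := by positivity
  have h := intervalIntegral.integral_eq_sub_of_hasDerivAt_of_le (zero_le_one (α := ℝ))
    (f := fun u : ℝ => u ^ (n + 1) / ((n : ℝ) + 1) ^ 2 - u ^ n * (u * Real.log u) / ((n : ℝ) + 1))
    (f' := fun u : ℝ => -(u ^ n * Real.log u)) (by
      have := Real.continuous_mul_log
      fun_prop) (fun u hu => by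
      have hu0 : u ≠ 0 := hu.1.ne'
      have e : (fun u : ℝ => u ^ (n + 1) / ((n : ℝ) + 1) ^ 2
          - u ^ n * (u * Real.log u) / ((n : ℝ) + 1)) =
          fun u : ℝ => u ^ (n + 1) / ((n : ℝ) + 1) ^ 2
            - u ^ (n + 1) * Real.log u / ((n : ℝ) + 1) := by
        ext u
        ring
      rw [e]
      have h := ((hasDerivAt_pow (n + 1) u).div_const (((n : ℝ) + 1) ^ 2)).sub
        (((hasDerivAt_pow (n + 1) u).mul (Real.hasDerivAt_log hu0)).div_const ((n : ℝ) + 1))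
      refine h.congr_deriv ?_
      simp only [Nat.cast_add, Nat.cast_one, Nat.add_sub_cancel]
      field_simp
      ring) (intervalIntegrable_neg_pow_mul_log n 0 1)
  simpa using h

lemma hasSum_neg_pow_mul_log {u : ℝ} (hu : 0 < u) (hu1 : u < 1) :
    HasSum (fun n : ℕ => -(u ^ n * Real.log u)) (dslope Real.log 1 u) := by
  have h := ((hasSum_geometric_of_lt_one hu.le hu1).mul_right (Real.log u)).neg
  rwa [dslope_log_one_of_ne hu1.ne, ← neg_sub 1 u, div_neg, div_eq_inv_mul]

lemma integral_dslope_log_one_zero_one :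
    ∫ u in (0 : ℝ)..1, dslope Real.log 1 u = Real.pi ^ 2 / 6 := by
  have hval (n : ℕ) : ∫ u in Set.Ioo (0 : ℝ) 1, -(u ^ n * Real.log u) =
      1 / ((n : ℝ) + 1) ^ 2 := by
    rw [← integral_neg_pow_mul_log n, intervalIntegral.integral_of_le zero_le_one,
      integral_Ioc_eq_integral_Ioo]
  have hnorm (n : ℕ) : ∫ u in Set.Ioo (0 : ℝ) 1, ‖-(u ^ n * Real.log u)‖ =
      1 / ((n : ℝ) + 1) ^ 2 := by
    rw [← hval n]
    refine setIntegral_congr_fun measurableSet_Ioo fun u hu => Real.norm_of_nonneg ?_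
    exact neg_nonneg.2 (mul_nonpos_of_nonneg_of_nonpos (pow_nonneg hu.1.le n)
      (Real.log_nonpos hu.1.le hu.2.le))
  have hz : HasSum (fun n : ℕ => 1 / ((n : ℝ) + 1) ^ 2) (Real.pi ^ 2 / 6) := by
    simpa using (hasSum_nat_add_iff' 1).2 hasSum_zeta_two
  have h := hasSum_integral_of_summable_integral_norm
    (μ := volume.restrict (Set.Ioo (0 : ℝ) 1)) (F := fun (n : ℕ) (u : ℝ) => -(u ^ n * Real.log u))
    (fun n => ((intervalIntegrable_iff_integrableOn_Ioo_of_le zero_le_one).1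
      (intervalIntegrable_neg_pow_mul_log n 0 1)))
    (by simpa only [hnorm] using hz.summable)
  simp only [hval] at h
  rw [intervalIntegral.integral_of_le zero_le_one, integral_Ioc_eq_integral_Ioo, ← h.unique hz]
  exact setIntegral_congr_fun measurableSet_Ioo fun u hu =>
    (hasSum_neg_pow_mul_log hu.1 hu.2).tsum_eq.symm

/-- The slope integral up to `x`, with the remainder expressed as an integral near `0`. -/
lemma integral_dslope_log_one_eq {x : ℝ} (hx : 0 < x) :
    ∫ t in (1 : ℝ)..x, dslope Real.log 1 t =
      Real.log x ^ 2 / 2 + Real.pi ^ 2 / 6 - ∫ u in (0 : ℝ)..x⁻¹, dslope Real.log 1 u := by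
  have h1 := integral_dslope_log_one_add_inv hx
  have h2 := intervalIntegral.integral_add_adjacent_intervals
    (intervalIntegrable_dslope_log_one_zero zero_le_one le_rfl)
    (intervalIntegrable_dslope_log_one one_pos (inv_pos.2 hx))
  rw [integral_dslope_log_one_zero_one] at h2
  linarith

lemma integral_log_div_one_sub {x : ℝ} (hx : 1 ≤ x) :
    ∫ t in (1 : ℝ)..x, Real.log t / (1 - t) = -∫ t in (1 : ℝ)..x, dslope Real.log 1 t := by
  rw [← intervalIntegral.integral_neg, intervalIntegral.integral_of_le hx,
    intervalIntegral.integral_of_le hx]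
  refine setIntegral_congr_fun measurableSet_Ioc fun t ht => ?_
  rw [dslope_log_one_of_ne ht.1.ne', ← neg_sub t 1, div_neg]

/-- Asymptotic expansion of `S₀` at infinity:
`S₀(r) = −2 log r + π²/6 + 2 + O((log r)²/r²)` as `r → ∞`. -/
theorem S0_asymptotic_expansion :
    ∃ C > (0 : ℝ), ∃ r₀ > (1 : ℝ), ∀ r ≥ r₀,
      |S0 r + 2 * Real.log r - (Real.pi ^ 2 / 6 + 2)| ≤ C * (Real.log r) ^ 2 / r ^ 2 := by
  refine ⟨30, by norm_num, Real.exp 1, by simp, fun r hr => ?_⟩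
  have hr0 : 0 < r := (Real.exp_pos 1).trans_le hr
  have hl : 1 ≤ Real.log r := (Real.le_log_iff_exp_le hr0).2 hr
  have hr1 : 1 ≤ r := (Real.one_le_exp zero_le_one).trans hr
  have hrr : 1 ≤ r ^ 2 := one_le_pow₀ hr1
  have hx : 0 < 1 + r ^ 2 := by positivity
  have hx1 : 1 ≤ 1 + r ^ 2 := by linarith
  have hy1 : (1 + r ^ 2)⁻¹ ≤ 1 := inv_le_one_of_one_le₀ hx1
  have hτ0 := integral_dslope_log_one_zero_nonneg (inv_pos.2 hx).le hy1
  have hτ1 := integral_dslope_log_one_zero_le (inv_pos.2 hx).le hy1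
  have hL0 : 0 ≤ Real.log (1 + r ^ 2) - 2 * Real.log r := by
    have := Real.log_le_log (by positivity) (by linarith : r ^ 2 ≤ 1 + r ^ 2)
    rw [Real.log_pow] at this
    push_cast at this
    linarith
  have hL1 : Real.log (1 + r ^ 2) - 2 * Real.log r ≤ (r ^ 2)⁻¹ := by
    have h := Real.log_le_sub_one_of_pos (x := (1 + r ^ 2) / r ^ 2) (by positivity)
    rw [Real.log_div hx.ne' (by positivity), Real.log_pow] at h
    have e : (1 + r ^ 2) / r ^ 2 - 1 = (r ^ 2)⁻¹ := by field_simp; ring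
    rw [e] at h
    exact_mod_cast h
  have hS : S0 r + 2 * Real.log r - (Real.pi ^ 2 / 6 + 2) =
      -((Real.log (1 + r ^ 2) - 2 * Real.log r)
        + (1 + r ^ 2)⁻¹ * (2 + Real.log (1 + r ^ 2) ^ 2 + Real.pi ^ 2 / 3)
        + (1 - 2 * (1 + r ^ 2)⁻¹) * ∫ u in (0 : ℝ)..(1 + r ^ 2)⁻¹, dslope Real.log 1 u) := by
    simp only [S0, T0]
    rw [integral_log_div_one_sub hx1, integral_dslope_log_one_eq hx]
    field_simp
    ring
  rw [Real.log_inv] at hτ1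
  have hyr : (1 + r ^ 2)⁻¹ ≤ (r ^ 2)⁻¹ := inv_anti₀ (by positivity) (by linarith)
  have hr2 : (r ^ 2)⁻¹ ≤ 1 := inv_le_one_of_one_le₀ hrr
  have hyhalf : 2 * (1 + r ^ 2)⁻¹ ≤ 1 := by
    rw [← div_eq_mul_inv, div_le_one hx]
    linarith
  have hypos : 0 < (1 + r ^ 2)⁻¹ := inv_pos.2 hx
  have hpi : Real.pi ^ 2 ≤ 16 := by nlinarith [Real.pi_le_four, Real.pi_pos]
  rw [hS, abs_neg, div_eq_mul_inv _ (r ^ 2)]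
  generalize (∫ u in (0 : ℝ)..(1 + r ^ 2)⁻¹, dslope Real.log 1 u) = τ at *
  generalize (1 + r ^ 2)⁻¹ = y at *
  generalize (r ^ 2)⁻¹ = z at *
  generalize Real.log (1 + r ^ 2) = L at *
  generalize Real.log r = l at *
  have hL : L ≤ 3 * l := by linarith
  have hLpos : 0 ≤ L := by linarith
  have hLsq : L ^ 2 ≤ 9 * l ^ 2 := by nlinarith
  have hτ : (1 - 2 * y) * τ ≤ y * (2 + L) :=
    (mul_le_of_le_one_left hτ0 (by linarith)).trans (by linarith)
  have hτ' : 0 ≤ (1 - 2 * y) * τ := mul_nonneg (by linarith) hτ0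
  have hmid : 0 ≤ y * (2 + L ^ 2 + Real.pi ^ 2 / 3) := by positivity
  rw [abs_of_nonneg (by linarith)]
  have hlsq : l ≤ l ^ 2 := by nlinarith
  have hsum : 4 + L + L ^ 2 + Real.pi ^ 2 / 3 ≤ 29 * l ^ 2 - 1 := by linarith
  have hbound : y * (4 + L + L ^ 2 + Real.pi ^ 2 / 3) ≤ z * (29 * l ^ 2 - 1) :=
    mul_le_mul hyr hsum (by positivity) (by linarith)
  nlinarith
end

section
/- Explicit coefficient A(γ) for a power–logarithmic tail: let a′ > 0, b′, c′ ∈ ℝ, R′ > 1, and let g : ℝ → ℝ be a twice continuously differentiable even function with g(t) > −1 for all t, such that g(t) = c′·t^{−a′}·(log t)^{−b′} for all t ≥ R′. Define H(t) = 1 + g(t) + g′(t)/(2t) for t > 0 and A(γ) = c′·a′·γ^{−(a′+2)}·(log γ)^{−b′}. Then: (i) lim_{γ→+∞} A(γ) = 0; (ii) for every T > 0, sup_{t∈[0,T]} |H(γ − t/γ) − H(γ)(1 + A(γ)t)| / (|H(γ)|(|A(γ)| + γ⁻⁴)) → 0 as γ → +∞; and (iii) there exist C > 0 and δ₀ ∈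 (0,1) such that |H(γ − t/γ) − H(γ)| ≤ C·|H(γ)|·(|A(γ)| + γ⁻⁴)·exp(δ₀ t) for all sufficiently large γ and all 0 ≤ t ≤ γ². -/
open Filter

/-- The power–logarithmic function `t ↦ t^{-p} (log t)^{-q}`. -/
noncomputable def powLog (p q t : ℝ) : ℝ := t ^ (-p) * Real.log t ^ (-q)

lemma powLog_pos (p q : ℝ) {t : ℝ} (ht : 1 < t) : 0 < powLog p q t :=
  mul_pos (Real.rpow_pos_of_pos (by linarith) _) (Real.rpow_pos_of_pos (Real.log_pos ht) _)

lemma powLog_add (p q p₁ q₁ : ℝ) {t : ℝ} (ht : 1 < t) :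
    powLog (p + p₁) (q + q₁) t = powLog p q t * powLog p₁ q₁ t := by
  have h0 : 0 < t := by linarith
  simp only [powLog, neg_add, Real.rpow_add h0, Real.rpow_add (Real.log_pos ht)]
  ring

lemma powLog_one_zero (t : ℝ) : powLog 1 0 t = t⁻¹ := by
  simp [powLog, Real.rpow_neg_one]

lemma powLog_zero_one (t : ℝ) : powLog 0 1 t = (Real.log t)⁻¹ := by
  simp [powLog, Real.rpow_neg_one]

lemma hasDerivAt_powLog (p q : ℝ) {t : ℝ} (ht : 1 < t) :
    HasDerivAt (powLog p q) (-p * powLog (p + 1) q t - q * powLog (p + 1) (q + 1) t) t := by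
  have h0 : 0 < t := by linarith
  have hl := Real.log_pos ht
  have h1 : HasDerivAt (fun t : ℝ => t ^ (-p)) (-p * t ^ (-p - 1)) t :=
    Real.hasDerivAt_rpow_const (Or.inl h0.ne')
  have h2 := (Real.hasDerivAt_log h0.ne').rpow_const (p := -q) (Or.inl hl.ne')
  refine (h1.mul h2).congr_deriv ?_
  simp only [powLog, neg_add, ← sub_eq_add_neg, Real.rpow_sub_one h0.ne',
    Real.rpow_sub_one hl.ne']
  field_simp
  ring

lemma tendsto_powLog_atTop {p : ℝ} (hp : 0 < p) (q : ℝ) :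
    Tendsto (powLog p q) atTop (nhds 0) := by
  refine (isLittleO_log_rpow_rpow_atTop (-q) hp).tendsto_div_nhds_zero.congr' ?_
  filter_upwards [eventually_gt_atTop 0] with t ht
  rw [powLog, Real.rpow_neg ht.le, div_eq_mul_inv, mul_comm]

lemma tendsto_powLog_zero_one_atTop : Tendsto (powLog 0 1) atTop (nhds 0) :=
  Real.tendsto_log_atTop.inv_tendsto_atTop.congr fun t => (powLog_zero_one t).symm

/-- The effect of rescaling the argument of `powLog p q`. -/
lemma powLog_mul (p q : ℝ) {γ x : ℝ} (hγ : 1 < γ) (hx : 0 < x) (hs : 1 < γ * x) :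
    powLog p q (γ * x) =
      powLog p q γ * (x ^ (-p) * (1 + Real.log x / Real.log γ) ^ (-q)) := by
  have h0 : 0 < γ := by linarith
  have hl := Real.log_pos hγ
  have hls := Real.log_pos hs
  have e : Real.log (γ * x) = Real.log γ * (1 + Real.log x / Real.log γ) := by
    rw [Real.log_mul h0.ne' hx.ne']
    field_simp
  have hy : 0 < 1 + Real.log x / Real.log γ := by
    rw [e] at hls
    exact pos_of_mul_pos_right hls hl.le
  simp only [powLog]
  rw [e, Real.mul_rpow h0.le hx.le, Real.mul_rpow hl.le hy.le]
  ring

/-- The function `1 + g + g' / (2t)` for `g = c · powLog a b`. -/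
noncomputable def powLogModel (a b c t : ℝ) : ℝ :=
  1 + c * powLog a b t - c / 2 * (a * powLog (a + 2) b t + b * powLog (a + 2) (b + 1) t)

/-- The relative correction in the derivative of `powLogModel`. -/
noncomputable def powLogCorrection (a b t : ℝ) : ℝ :=
  b * powLog 0 1 t - (a * (a + 2) * powLog 2 0 t + (a * b + b * (a + 2)) * powLog 2 1 t
    + b * (b + 1) * powLog 2 2 t) / 2

lemma tendsto_powLogModel {a : ℝ} (ha : 0 < a) (b c : ℝ) :
    Tendsto (powLogModel a b c) atTop (nhds 1) := by
  have h1 := tendsto_powLog_atTop ha b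
  have h2 := tendsto_powLog_atTop (show 0 < a + 2 by linarith) b
  have h3 := tendsto_powLog_atTop (show 0 < a + 2 by linarith) (b + 1)
  have h := ((h1.const_mul c).const_add 1).sub
    (((h2.const_mul a).add (h3.const_mul b)).const_mul (c / 2))
  simp only [mul_zero, add_zero, sub_zero] at h
  exact h

lemma tendsto_powLogCorrection (a b : ℝ) :
    Tendsto (powLogCorrection a b) atTop (nhds 0) := by
  have h (q : ℝ) := tendsto_powLog_atTop (show (0 : ℝ) < 2 by norm_num) q
  have h' := (tendsto_powLog_zero_one_atTop.const_mul b).sub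
    (((((h 0).const_mul (a * (a + 2))).add ((h 1).const_mul (a * b + b * (a + 2)))).add
      ((h 2).const_mul (b * (b + 1)))).div_const 2)
  simp only [mul_zero, add_zero, sub_zero, zero_div] at h'
  exact h'

lemma hasDerivAt_powLogModel (a b c : ℝ) {t : ℝ} (ht : 1 < t) :
    HasDerivAt (powLogModel a b c)
      (-c * powLog (a + 1) b t * (a + powLogCorrection a b t)) t := by
  have h1 := hasDerivAt_powLog a b ht
  have h2 := hasDerivAt_powLog (a + 2) b ht
  have h3 := hasDerivAt_powLog (a + 2) (b + 1) ht
  have h := ((h1.const_mul c).const_add 1).sub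
    (((h2.const_mul a).add (h3.const_mul b)).const_mul (c / 2))
  refine h.congr_deriv ?_
  have e1 : powLog (a + 1) (b + 1) t = powLog (a + 1) b t * powLog 0 1 t := by
    simpa using powLog_add (a + 1) b 0 1 ht
  have e2 : powLog (a + 2 + 1) b t = powLog (a + 1) b t * powLog 2 0 t := by
    rw [← powLog_add _ _ _ _ ht]; ring_nf
  have e3 : powLog (a + 2 + 1) (b + 1) t = powLog (a + 1) b t * powLog 2 1 t := by
    rw [← powLog_add _ _ _ _ ht]; ring_nf
  have e4 : powLog (a + 2 + 1) (b + 1 + 1) t = powLog (a + 1) b t * powLog 2 2 t := by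
    rw [← powLog_add _ _ _ _ ht]; ring_nf
  rw [e1, e2, e3, e4, powLogCorrection]
  ring

/-- Beyond `R`, the function `1 + g + g' / (2t)` only sees the tail of `g`. -/
lemma eq_powLogModel_of_tail {a b c R : ℝ} (hR : 1 < R) {g : ℝ → ℝ}
    (hg : ∀ t ≥ R, g t = c * t ^ (-a) * Real.log t ^ (-b)) {t : ℝ} (ht : R < t) :
    1 + g t + deriv g t / (2 * t) = powLogModel a b c t := by
  have ht1 : 1 < t := hR.trans ht
  have h0 : t ≠ 0 := by linarith
  have hd : deriv g t = c * (-a * powLog (a + 1) b t - b * powLog (a + 1) (b + 1) t) := by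
    refine (((hasDerivAt_powLog a b ht1).const_mul c).congr_of_eventuallyEq ?_).deriv
    filter_upwards [lt_mem_nhds ht] with s hs
    rw [hg s hs.le, powLog, mul_assoc]
  have e (q : ℝ) : powLog (a + 2) q t = powLog (a + 1) q t * t⁻¹ := by
    rw [← powLog_one_zero t, ← powLog_add _ _ _ _ ht1]; ring_nf
  rw [hd, hg t ht.le, powLogModel, e, e, mul_assoc, ← powLog]
  field_simp
  ring

/-- For `g` even and `C²`, the singularity of `g' / (2t)` at `0` is removable, so that
`1 + g + g' / (2t)` is bounded on bounded intervals. -/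
lemma exists_bound_of_even {g : ℝ → ℝ} (hg : ContDiff ℝ 2 g) (heven : ∀ t, g (-t) = g t)
    (N : ℝ) : ∃ K, ∀ t ∈ Set.Icc 0 N, |1 + g t + deriv g t / (2 * t)| ≤ K := by
  obtain ⟨K₁, hK₁⟩ := isCompact_Icc.exists_bound_of_continuousOn
    (s := Set.Icc 0 N) hg.continuous.continuousOn
  have hd1 : ContDiff ℝ 1 (deriv g) := by
    have : ContDiff ℝ (1 + 1) g := by simpa [one_add_one_eq_two] using hg
    exact (contDiff_succ_iff_deriv.1 this).2.2
  obtain ⟨K₂, hK₂⟩ := isCompact_Icc.exists_bound_of_continuousOn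
    (s := Set.Icc 0 N) (hd1.continuous_deriv le_rfl).continuousOn
  have hd0 : deriv g 0 = 0 := by
    have h := deriv_comp_neg g 0
    simp only [heven, neg_zero] at h
    linarith
  refine ⟨1 + K₁ + K₂ / 2, fun t ht => ?_⟩
  have h1 := hK₁ t ht
  have hK₂0 : 0 ≤ K₂ := (norm_nonneg _).trans (hK₂ t ht)
  have h2 : |deriv g t| ≤ K₂ * t := by
    have := (convex_Icc (0 : ℝ) N).norm_image_sub_le_of_norm_deriv_le
      (fun x _ => (hd1.differentiable one_ne_zero) x) hK₂
      (Set.left_mem_Icc.2 (ht.1.trans ht.2)) ht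
    simpa [hd0, abs_of_nonneg ht.1] using this
  have h3 : |deriv g t / (2 * t)| ≤ K₂ / 2 := by
    rcases ht.1.eq_or_lt with h | h
    · rw [← h, mul_zero, div_zero, abs_zero]
      positivity
    · rw [abs_div, abs_of_pos (by linarith : 0 < 2 * t), div_le_iff₀ (by linarith)]
      linarith
  calc |1 + g t + deriv g t / (2 * t)| ≤ |1 + g t| + |deriv g t / (2 * t)| := abs_add_le _ _
    _ ≤ (|1| + |g t|) + |deriv g t / (2 * t)| := by gcongr; exact abs_add_le _ _
    _ ≤ 1 + K₁ + K₂ / 2 := by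
      rw [abs_one]
      rw [Real.norm_eq_abs] at h1
      linarith

/-- The mean value inequality along `t ↦ γ - t / γ`. -/
lemma abs_powLogModel_sub_le {a b c γ S κ B : ℝ}
    (hS : ∀ t ∈ Set.Icc 0 S, 1 < γ - t / γ)
    (hB : ∀ t ∈ Set.Icc 0 S,
      |c * powLog (a + 1) b (γ - t / γ) * (a + powLogCorrection a b (γ - t / γ)) / γ - κ| ≤ B)
    {t : ℝ} (ht : t ∈ Set.Icc 0 S) :
    |powLogModel a b c (γ - t / γ) - powLogModel a b c γ - κ * t| ≤ B * t := by
  have hd : ∀ x ∈ Set.Icc 0 S, HasDerivWithinAt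
      (fun t => powLogModel a b c (γ - t / γ) - κ * t)
      (c * powLog (a + 1) b (γ - x / γ) * (a + powLogCorrection a b (γ - x / γ)) / γ - κ)
      (Set.Icc 0 S) x := by
    intro x hx
    have h1 : HasDerivAt (fun t => γ - t / γ) (-(1 / γ)) x :=
      ((hasDerivAt_id x).div_const γ).const_sub γ
    have h2 := (hasDerivAt_powLogModel a b c (hS x hx)).comp x h1
    have h3 := h2.sub ((hasDerivAt_id x).const_mul κ)
    refine (h3.congr_deriv ?_).hasDerivWithinAt
    ring
  have := (convex_Icc 0 S).norm_image_sub_le_of_norm_hasDerivWithin_le hd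
    hB (Set.left_mem_Icc.2 (ht.1.trans ht.2)) ht
  simp only [Real.norm_eq_abs, zero_div, sub_zero, mul_zero, abs_of_nonneg ht.1] at this
  convert this using 2
  ring

/-- Along `t ↦ γ - t / γ`, the derivative of `powLogModel` in terms of its value at `γ`. -/
lemma powLog_deriv_rescale {a : ℝ} (ha : 0 < a) (b c : ℝ) {γ t : ℝ} (hγ : 1 < γ)
    (hs : 1 < γ - t / γ) :
    c * powLog (a + 1) b (γ - t / γ) * (a + powLogCorrection a b (γ - t / γ)) / γ =
      c * a * powLog (a + 2) b γ *
        ((1 - t / γ ^ 2) ^ (-(a + 1)) *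
          (1 + Real.log (1 - t / γ ^ 2) / Real.log γ) ^ (-b) *
          (1 + powLogCorrection a b (γ - t / γ) / a)) := by
  have h0 : 0 < γ := by linarith
  have e : γ - t / γ = γ * (1 - t / γ ^ 2) := by field_simp
  have hs' : 1 < γ * (1 - t / γ ^ 2) := e ▸ hs
  have hx : 0 < 1 - t / γ ^ 2 := pos_of_mul_pos_right (by linarith : 0 < γ * _) h0.le
  have e2 : powLog (a + 2) b γ = powLog (a + 1) b γ * γ⁻¹ := by
    rw [← powLog_one_zero γ, ← powLog_add _ _ _ _ hγ]; ring_nf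
  have e3 : powLog (a + 1) b (γ - t / γ) = _ :=
    (congrArg _ e).trans (powLog_mul (a + 1) b hγ hx hs')
  rw [e3, e2]
  field_simp

lemma tendsto_div_sq_prod_principal (T : ℝ) :
    Tendsto (fun z : ℝ × ℝ => z.2 / z.1 ^ 2) (atTop ×ˢ 𝓟 (Set.Icc 0 T)) (nhds 0) := by
  have h : Tendsto (fun z : ℝ × ℝ => T / z.1 ^ 2) (atTop ×ˢ 𝓟 (Set.Icc 0 T)) (nhds 0) :=
    ((tendsto_pow_atTop two_ne_zero).const_div_atTop T).comp tendsto_fst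
  have hmem : ∀ᶠ z : ℝ × ℝ in atTop ×ˢ 𝓟 (Set.Icc 0 T), z.2 ∈ Set.Icc 0 T :=
    tendsto_snd.eventually (mem_principal_self _)
  refine tendsto_of_tendsto_of_tendsto_of_le_of_le' tendsto_const_nhds h ?_ ?_
  · filter_upwards [hmem] with z hz
    exact div_nonneg hz.1 (sq_nonneg _)
  · filter_upwards [hmem] with z hz
    exact div_le_div_of_nonneg_right hz.2 (sq_nonneg _)

lemma tendsto_sub_div_prod_principal (T : ℝ) :
    Tendsto (fun z : ℝ × ℝ => z.1 - z.2 / z.1) (atTop ×ˢ 𝓟 (Set.Icc 0 T)) atTop := by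
  have h1 : Tendsto (fun z : ℝ × ℝ => 1 - z.2 / z.1 ^ 2) (atTop ×ˢ 𝓟 (Set.Icc 0 T))
      (nhds 1) := by
    simpa using (tendsto_div_sq_prod_principal T).const_sub 1
  refine ((tendsto_fst (f := atTop) (g := 𝓟 (Set.Icc 0 T))).atTop_mul_pos one_pos h1).congr' ?_
  filter_upwards [tendsto_fst.eventually (eventually_gt_atTop (0 : ℝ))] with z hz
  field_simp

/-- The rescaled derivative converges uniformly to `1` on bounded intervals. -/
lemma tendsto_rescale_factor (a b T : ℝ) :
    Tendsto (fun z : ℝ × ℝ => (1 - z.2 / z.1 ^ 2) ^ (-(a + 1)) *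
          (1 + Real.log (1 - z.2 / z.1 ^ 2) / Real.log z.1) ^ (-b) *
          (1 + powLogCorrection a b (z.1 - z.2 / z.1) / a))
      (atTop ×ˢ 𝓟 (Set.Icc 0 T)) (nhds 1) := by
  have h1 : Tendsto (fun z : ℝ × ℝ => 1 - z.2 / z.1 ^ 2) (atTop ×ˢ 𝓟 (Set.Icc 0 T))
      (nhds 1) := by
    simpa using (tendsto_div_sq_prod_principal T).const_sub 1
  have hl : Tendsto (fun z : ℝ × ℝ => Real.log z.1) (atTop ×ˢ 𝓟 (Set.Icc 0 T)) atTop :=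
    Real.tendsto_log_atTop.comp tendsto_fst
  have h2 : Tendsto (fun z : ℝ × ℝ => 1 + Real.log (1 - z.2 / z.1 ^ 2) / Real.log z.1)
      (atTop ×ˢ 𝓟 (Set.Icc 0 T)) (nhds 1) := by
    simpa using ((h1.log one_ne_zero).div_atTop hl).const_add 1
  have h3 := (((tendsto_powLogCorrection a b).comp
    (tendsto_sub_div_prod_principal T)).div_const a).const_add 1
  simpa using ((h1.rpow_const (p := -(a + 1)) (Or.inl one_ne_zero)).mul
    (h2.rpow_const (p := -b) (Or.inl one_ne_zero))).mul h3

lemma rpow_neg_le_two_rpow_abs {x : ℝ} (p : ℝ) (h1 : 1 / 2 ≤ x) (h2 : x ≤ 1) :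
    x ^ (-p) ≤ 2 ^ |p| := by
  have h0 : 0 < x := by linarith
  calc x ^ (-p) ≤ x ^ (-|p|) :=
        Real.rpow_le_rpow_of_exponent_ge h0 h2 (neg_le_neg (le_abs_self p))
    _ ≤ (1 / 2) ^ (-|p|) :=
        Real.rpow_le_rpow_of_nonpos (by norm_num) h1 (neg_nonpos.2 (abs_nonneg p))
    _ = 2 ^ |p| := by
        rw [one_div, Real.inv_rpow (by norm_num), Real.rpow_neg (by norm_num), inv_inv]

/-- Local linearisation of `powLogModel` at `γ`, uniform for `t` in a bounded interval. -/
lemma eventually_powLogModel_linearisation {a : ℝ} (ha : 0 < a) (b c T : ℝ) {η : ℝ}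
    (hη : 0 < η) :
    ∀ᶠ γ in atTop, ∀ t ∈ Set.Icc 0 T,
      |powLogModel a b c (γ - t / γ) -
        powLogModel a b c γ * (1 + c * a * powLog (a + 2) b γ * t)| ≤
        η * |c * a * powLog (a + 2) b γ| * t := by
  have hm : Tendsto (fun z : ℝ × ℝ => powLogModel a b c z.1) (atTop ×ˢ 𝓟 (Set.Icc 0 T))
      (nhds 1) := (tendsto_powLogModel ha b c).comp tendsto_fst
  have h := (tendsto_rescale_factor a b T).sub hm
  rw [sub_self] at h
  have h' := eventually_prod_principal_iff.1
    ((h.abs.eventually (gt_mem_nhds (by simpa using hη))).and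
      ((tendsto_sub_div_prod_principal T).eventually (eventually_gt_atTop 1)))
  filter_upwards [h', eventually_gt_atTop 1] with γ hγ hγ1 t ht
  have := abs_powLogModel_sub_le (a := a) (b := b) (c := c) (γ := γ) (S := T)
    (κ := powLogModel a b c γ * (c * a * powLog (a + 2) b γ))
    (B := η * |c * a * powLog (a + 2) b γ|) (fun t ht => (hγ t ht).2) ?_ ht
  · convert this using 2
    ring
  · intro s hs
    rw [powLog_deriv_rescale ha b c hγ1 (hγ s hs).2, mul_comm (powLogModel a b c γ),
      ← mul_sub, abs_mul, mul_comm]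
    exact mul_le_mul_of_nonneg_right (hγ s hs).1.le (abs_nonneg _)

/-- A Lipschitz bound for `powLogModel` between `γ / 2` and `γ`. -/
lemma exists_powLogModel_lipschitz {a : ℝ} (ha : 0 < a) (b c : ℝ) :
    ∃ M > 0, ∀ᶠ γ in atTop, ∀ t ∈ Set.Icc 0 (γ ^ 2 / 2),
      |powLogModel a b c (γ - t / γ) - powLogModel a b c γ| ≤
        M * |c * a * powLog (a + 2) b γ| * t := by
  refine ⟨2 ^ |a + 1| * 2 ^ |b| * 2, by positivity, ?_⟩
  have hε : ∀ᶠ t in atTop, |1 + powLogCorrection a b t / a| < 2 := by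
    have := (((tendsto_powLogCorrection a b).div_const a).const_add 1).abs
    exact this.eventually (gt_mem_nhds (by norm_num))
  obtain ⟨N, hN⟩ := eventually_atTop.1 hε
  filter_upwards [eventually_gt_atTop 2, eventually_ge_atTop (2 * N),
    Real.tendsto_log_atTop.eventually (eventually_ge_atTop (2 * Real.log 2))]
    with γ hγ hγN hγl t ht
  have h0 : 0 < γ := by linarith
  have hs : ∀ t ∈ Set.Icc 0 (γ ^ 2 / 2), γ / 2 ≤ γ - t / γ := by
    intro t ht
    have : t / γ ≤ γ / 2 := by
      rw [div_le_iff₀ h0]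
      linarith [ht.2]
    linarith
  have hs1 : ∀ t ∈ Set.Icc 0 (γ ^ 2 / 2), 1 < γ - t / γ := fun t ht => by
    linarith [hs t ht]
  have := abs_powLogModel_sub_le (a := a) (b := b) (c := c) (γ := γ) (S := γ ^ 2 / 2)
    (κ := 0) (B := 2 ^ |a + 1| * 2 ^ |b| * 2 * |c * a * powLog (a + 2) b γ|) hs1 ?_ ht
  · simpa using this
  · intro s hs'
    have hx1 : 1 / 2 ≤ 1 - s / γ ^ 2 := by
      have : s / γ ^ 2 ≤ 1 / 2 := by
        rw [div_le_iff₀ (by positivity)]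
        linarith [hs'.2]
      linarith
    have hx2 : 1 - s / γ ^ 2 ≤ 1 := by
      have : 0 ≤ s / γ ^ 2 := div_nonneg hs'.1 (sq_nonneg _)
      linarith
    have hl2 : 0 < Real.log 2 := Real.log_pos (by norm_num)
    have hl0 : 0 < Real.log γ := by linarith
    have hy2 : 1 + Real.log (1 - s / γ ^ 2) / Real.log γ ≤ 1 := by
      have : Real.log (1 - s / γ ^ 2) / Real.log γ ≤ 0 :=
        div_nonpos_of_nonpos_of_nonneg (Real.log_nonpos (by linarith) hx2) hl0.le
      linarith
    have hy1 : 1 / 2 ≤ 1 + Real.log (1 - s / γ ^ 2) / Real.log γ := by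
      have h1 : -Real.log 2 ≤ Real.log (1 - s / γ ^ 2) := by
        have := Real.log_le_log (by norm_num) hx1
        rwa [one_div, Real.log_inv] at this
      have : -(1 / 2) ≤ Real.log (1 - s / γ ^ 2) / Real.log γ := by
        rw [le_div_iff₀ hl0]
        linarith
      linarith
    rw [powLog_deriv_rescale ha b c (by linarith) (hs1 s hs'), sub_zero, abs_mul, mul_comm]
    refine mul_le_mul_of_nonneg_right ?_ (abs_nonneg _)
    rw [abs_mul, abs_mul, abs_of_nonneg (Real.rpow_nonneg (by linarith) _),
      abs_of_nonneg (Real.rpow_nonneg (by linarith) _)]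
    have h1 := rpow_neg_le_two_rpow_abs (a + 1) hx1 hx2
    have h2 := rpow_neg_le_two_rpow_abs b hy1 hy2
    have h3 := (hN (γ - s / γ) (by linarith [hs s hs'])).le
    gcongr

lemma one_le_mul_inv_pow_four_mul_exp {γ t : ℝ} (hγ : 0 < γ) (ht : γ ^ 2 / 2 ≤ t) :
    1 ≤ 32 * (γ ^ 4)⁻¹ * Real.exp (1 / 2 * t) := by
  have h1 := Real.quadratic_le_exp_of_nonneg (show 0 ≤ γ ^ 2 / 4 by positivity)
  have h2 : Real.exp (γ ^ 2 / 4) ≤ Real.exp (1 / 2 * t) := Real.exp_le_exp.2 (by linarith)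
  have h3 : γ ^ 4 ≤ 32 * Real.exp (1 / 2 * t) := by nlinarith [sq_nonneg γ]
  calc (1 : ℝ) = γ ^ 4 * (γ ^ 4)⁻¹ := (mul_inv_cancel₀ (by positivity)).symm
    _ ≤ 32 * Real.exp (1 / 2 * t) * (γ ^ 4)⁻¹ := by gcongr
    _ = _ := by ring

/-- Explicit coefficient `A(γ)` for a power–logarithmic tail
`g(t) = c′·t^{−a′}·(log t)^{−b′}` for large `t`:
`A(γ) = c′·a′·γ^{−(a′+2)}·(log γ)^{−b′}` satisfies hypothesis (H∞). -/
theorem explicit_A_for_power_log_tail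
    (a' b' c' R' : ℝ) (ha' : 0 < a') (hR' : 1 < R')
    (g : ℝ → ℝ) (hg2 : ContDiff ℝ 2 g) (hgeven : ∀ t, g (-t) = g t)
    (hgpos : ∀ t, g t > -1)
    (hgR : ∀ t ≥ R', g t = c' * t ^ (-a') * Real.log t ^ (-b'))
    (H : ℝ → ℝ) (hH : ∀ t, H t = 1 + g t + deriv g t / (2 * t))
    (A : ℝ → ℝ)
    (hA : ∀ γ, A γ = c' * a' * γ ^ (-(a' + 2)) * Real.log γ ^ (-b')) :
    Tendsto A atTop (nhds 0) ∧
    (∀ T > (0 : ℝ), Tendsto (fun γ : ℝ =>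
      (⨆ t : Set.Icc (0 : ℝ) T, |H (γ - (t : ℝ) / γ) - H γ * (1 + A γ * (t : ℝ))|)
        / (|H γ| * (|A γ| + (γ ^ 4)⁻¹))) atTop (nhds 0)) ∧
    ∃ C > (0 : ℝ), ∃ δ₀ ∈ Set.Ioo (0 : ℝ) 1, ∀ᶠ γ : ℝ in atTop,
      ∀ t ∈ Set.Icc (0 : ℝ) (γ ^ 2),
        |H (γ - t / γ) - H γ| ≤ C * |H γ| * (|A γ| + (γ ^ 4)⁻¹) * Real.exp (δ₀ * t) := by
  have hA' : ∀ γ, A γ = c' * a' * powLog (a' + 2) b' γ := fun γ => by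
    rw [hA, powLog, mul_assoc]
  have hHm : ∀ t, R' < t → H t = powLogModel a' b' c' t := fun t ht => by
    rw [hH, eq_powLogModel_of_tail hR' hgR ht]
  have hHlim : Tendsto H atTop (nhds 1) :=
    (tendsto_powLogModel ha' b' c').congr' <| by
      filter_upwards [eventually_gt_atTop R'] with t ht using (hHm t ht).symm
  have hHlow : ∀ᶠ γ in atTop, 1 / 2 ≤ |H γ| := by
    filter_upwards [hHlim.eventually (lt_mem_nhds (show (1 / 2 : ℝ) < 1 by norm_num))]
      with γ hγ using hγ.le.trans (le_abs_self _)
  refine ⟨?_, fun T hT => ?_, ?_⟩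
  · have := (tendsto_powLog_atTop (show 0 < a' + 2 by linarith) b').const_mul (c' * a')
    rw [mul_zero] at this
    exact this.congr fun γ => (hA' γ).symm
  · have hne : Nonempty (Set.Icc (0 : ℝ) T) := ⟨⟨0, le_rfl, hT.le⟩⟩
    rw [Metric.tendsto_nhds]
    intro e he
    have hη : 0 < e / (4 * T) := by positivity
    filter_upwards [eventually_powLogModel_linearisation ha' b' c' T hη, hHlow,
      eventually_gt_atTop R', eventually_gt_atTop 0,
      eventually_prod_principal_iff.1 ((tendsto_sub_div_prod_principal T).eventually
        (eventually_gt_atTop R'))] with γ hγ hγH hγR hγ0 hγs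
    have hsup : (⨆ t : Set.Icc (0 : ℝ) T,
        |H (γ - (t : ℝ) / γ) - H γ * (1 + A γ * (t : ℝ))|) ≤ e / 4 * |A γ| := by
      refine ciSup_le fun t => ?_
      have := hγ t t.2
      rw [← hHm _ (hγs t t.2), ← hHm _ hγR, ← hA'] at this
      refine this.trans ?_
      calc e / (4 * T) * |A γ| * t ≤ e / (4 * T) * |A γ| * T := by
            gcongr
            exact t.2.2
        _ = e / 4 * |A γ| := by field_simp
    have hsup0 : 0 ≤ (⨆ t : Set.Icc (0 : ℝ) T,
        |H (γ - (t : ℝ) / γ) - H γ * (1 + A γ * (t : ℝ))|) :=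
      Real.iSup_nonneg fun t => abs_nonneg _
    have hp : 0 < |A γ| + (γ ^ 4)⁻¹ := by positivity
    have hA0 : |A γ| ≤ |A γ| + (γ ^ 4)⁻¹ := by
      have : 0 ≤ (γ ^ 4)⁻¹ := by positivity
      linarith
    have hd : 0 < |H γ| * (|A γ| + (γ ^ 4)⁻¹) := mul_pos (by linarith) hp
    rw [Real.dist_eq, sub_zero, abs_of_nonneg (div_nonneg hsup0 hd.le), div_lt_iff₀ hd]
    calc _ ≤ e / 4 * |A γ| := hsup
      _ ≤ e / 4 * (|A γ| + (γ ^ 4)⁻¹) := by gcongr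
      _ < e * (1 / 2 * (|A γ| + (γ ^ 4)⁻¹)) := by nlinarith [mul_pos he hp]
      _ ≤ e * (|H γ| * (|A γ| + (γ ^ 4)⁻¹)) := by gcongr
  · obtain ⟨M, hM, hMb⟩ := exists_powLogModel_lipschitz ha' b' c'
    obtain ⟨N, hN⟩ := eventually_atTop.1
      (hHlim.abs.eventually (gt_mem_nhds (show |(1 : ℝ)| < 2 by norm_num)))
    obtain ⟨K, hK⟩ := exists_bound_of_even hg2 hgeven N
    have hbound : ∀ t, 0 ≤ t → |H t| ≤ |K| + 2 := by
      intro t ht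
      rcases le_total t N with h | h
      · rw [hH]
        linarith [hK t ⟨ht, h⟩, le_abs_self K]
      · linarith [hN t h, abs_nonneg K]
    refine ⟨4 * M + 128 * (|K| + 2), by positivity, 1 / 2, ⟨by norm_num, by norm_num⟩, ?_⟩
    filter_upwards [hMb, hHlow, eventually_gt_atTop (2 * R'), eventually_gt_atTop 0]
      with γ hγM hγH hγR hγ0 t ht
    have hp : 0 < (γ ^ 4)⁻¹ := by positivity
    rcases le_total t (γ ^ 2 / 2) with h | h
    · have h1 : R' < γ - t / γ := by
        have : t / γ ≤ γ / 2 := by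
          rw [div_le_iff₀ hγ0]
          linarith
        linarith
      have h2 := hγM t ⟨ht.1, h⟩
      rw [← hHm _ h1, ← hHm γ (by linarith), ← hA'] at h2
      have h3 : t ≤ 2 * Real.exp (1 / 2 * t) := by
        linarith [Real.add_one_le_exp (1 / 2 * t)]
      calc |H (γ - t / γ) - H γ| ≤ M * |A γ| * t := h2
        _ ≤ M * |A γ| * (2 * Real.exp (1 / 2 * t)) := by gcongr
        _ = 4 * M * (1 / 2) * |A γ| * Real.exp (1 / 2 * t) := by ring
        _ ≤ _ := by
          gcongr
          · linarith [abs_nonneg K]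
          · linarith
    · have h1 : 0 ≤ γ - t / γ := by
        have : t / γ ≤ γ := by
          rw [div_le_iff₀ hγ0]
          linarith [ht.2]
        linarith
      calc |H (γ - t / γ) - H γ| ≤ |H (γ - t / γ)| + |H γ| := abs_sub _ _
        _ ≤ 2 * (|K| + 2) * 1 := by linarith [hbound _ h1, hbound γ hγ0.le]
        _ ≤ 2 * (|K| + 2) * (32 * (γ ^ 4)⁻¹ * Real.exp (1 / 2 * t)) := by
          gcongr
          exact one_le_mul_inv_pow_four_mul_exp hγ0 h
        _ = 128 * (|K| + 2) * (1 / 2) * (γ ^ 4)⁻¹ * Real.exp (1 / 2 * t) := by ring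
        _ ≤ _ := by
          gcongr
          · linarith
          · linarith [abs_nonneg (A γ)]
end
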